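/- arXiv:2510.23369 — 8 statements merged into one kernel-verified Lean document; each statement's English description precedes it below -/
import Mathlib

section
/- Let C be an idempotent complete preadditive category that has weak kernels and weak cokernels, and let n ≥ 1 be an integer. Then C has n-kernels if and only if C has n-cokernels. -/
/-!
STATEMENT 0: Let `C` be an idempotent complete preadditive category that has weak kernels
and weak cokernels, and let `n ≥ 1` be an integer. Then `C` has `n`-kernels if and only if
`C` has `n`-cokernels.
-/

open CategoryTheory CategoryTheory.Limits

universe v u

variable {C : Type u} [Category.{v} C] [Preadditive C]

/-- A weak kernel of `f : A ⟶ B` is a morphism `w : K ⟶ A` with `w ≫ f = 0` such that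
every `g : X ⟶ A` with `g ≫ f = 0` factors through `w`. -/
def IsWeakKernel {K A B : C} (w : K ⟶ A) (f : A ⟶ B) : Prop :=
  w ≫ f = 0 ∧ ∀ ⦃X : C⦄ (g : X ⟶ A), g ≫ f = 0 → ∃ h : X ⟶ K, g = h ≫ w

/-- A weak cokernel of `f : A ⟶ B` is a morphism `w : B ⟶ K` with `f ≫ w = 0` such that
every `g : B ⟶ X` with `f ≫ g = 0` factors through `w`. -/
def IsWeakCokernel {A B K : C} (f : A ⟶ B) (w : B ⟶ K) : Prop :=
  f ≫ w = 0 ∧ ∀ ⦃X : C⦄ (g : B ⟶ X), f ≫ g = 0 → ∃ h : K ⟶ X, g = w ≫ h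

/-- `AdmitsNKernel n f` says that the morphism `f` admits an `n`-kernel.
For `n ≥ 1`, an `n`-kernel of `f : A ⟶ B` is a sequence `B₁ ⟶ B₂ ⟶ ⋯ ⟶ Bₙ ⟶ A` such
that `bₙ` is a weak kernel of `f`, each `bᵢ` is a weak kernel of `bᵢ₊₁`, and `b₁` is a
monomorphism; equivalently (and this is the recursive formulation used here), `bₙ` is a
weak kernel of `f` and `b₁, …, bₙ₋₁` is an `(n-1)`-kernel of `bₙ`.
(For completeness the definition also covers `n = 0`, where a `0`-kernel of `f` is a
monomorphism `m : I ⟶ B` with `f = m ∘ e` for some split epimorphism `e : A ⟶ I`.) -/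
def AdmitsNKernel : (n : ℕ) → ∀ {A B : C}, (A ⟶ B) → Prop
  | 0, A, B, f => ∃ (I : C) (e : A ⟶ I) (m : I ⟶ B) (s : I ⟶ A),
      Mono m ∧ f = e ≫ m ∧ s ≫ e = 𝟙 I
  | 1, A, _, f => ∃ (K : C) (w : K ⟶ A), IsWeakKernel w f ∧ Mono w
  | (n + 2), A, _, f => ∃ (K : C) (w : K ⟶ A), IsWeakKernel w f ∧ AdmitsNKernel (n + 1) w

/-- `AdmitsNCokernel n f` says that the morphism `f` admits an `n`-cokernel; this is
the notion dual to `AdmitsNKernel`. -/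
def AdmitsNCokernel : (n : ℕ) → ∀ {A B : C}, (A ⟶ B) → Prop
  | 0, A, B, f => ∃ (I : C) (e : A ⟶ I) (m : I ⟶ B) (r : B ⟶ I),
      Epi e ∧ f = e ≫ m ∧ m ≫ r = 𝟙 I
  | 1, _, B, f => ∃ (K : C) (w : B ⟶ K), IsWeakCokernel f w ∧ Epi w
  | (n + 2), _, B, f => ∃ (K : C) (w : B ⟶ K), IsWeakCokernel f w ∧ AdmitsNCokernel (n + 1) w

/-- `IsIteratedWeakCokernel m x` says that `x` is the last morphism of a sequence of `m + 1`
composable morphisms, each of which, except the first, is a weak cokernel of the previous one. -/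
def IsIteratedWeakCokernel : (m : ℕ) → ∀ {X Y : C}, (X ⟶ Y) → Prop
  | 0, _, _, _ => True
  | (m + 1), X, _, x => ∃ (W : C) (y : W ⟶ X), IsWeakCokernel y x ∧ IsIteratedWeakCokernel m y

theorem IsWeakCokernel.exists_eq_comp_of_mono {W X Y K L : C} {y : W ⟶ X} {x : X ⟶ Y}
    (hy : IsWeakCokernel y x) (g : K ⟶ L) [Mono g] {φ : X ⟶ K} {ψ : Y ⟶ L}
    (h : φ ≫ g = x ≫ ψ) : ∃ s : Y ⟶ K, φ = x ≫ s := by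
  refine hy.2 φ ?_
  rw [← cancel_mono g, Category.assoc, h, ← Category.assoc, hy.1, zero_comp, zero_comp]

/-- If `φ` and the map it induces between a weak cokernel and a weak kernel are compatible up to
`s₁`, then `φ` itself is null-homotopic after composition with `g`. -/
theorem IsWeakCokernel.exists_comp_eq {W X Y J K L : C} {y : W ⟶ X} {x : X ⟶ Y}
    (hy : IsWeakCokernel y x) {k : J ⟶ K} {g : K ⟶ L} (hk : IsWeakKernel k g) {φ : X ⟶ K}
    (s₁ : X ⟶ J) (h : y ≫ φ = y ≫ s₁ ≫ k) : ∃ s : Y ⟶ K, φ ≫ g = x ≫ s ≫ g := by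
  obtain ⟨s, hs⟩ := hy.2 (φ - s₁ ≫ k) (by rw [Preadditive.comp_sub, h, sub_self])
  refine ⟨s, ?_⟩
  rw [← Category.assoc, ← hs, Preadditive.sub_comp, Category.assoc, hk.1, comp_zero, sub_zero]

/-- A commutative square from an iterated weak cokernel to a morphism with an `n`-kernel is
null-homotopic. -/
theorem AdmitsNKernel.exists_comp_eq (m : ℕ) : ∀ {X Y K L : C} {x : X ⟶ Y} {g : K ⟶ L},
    IsIteratedWeakCokernel (m + 2) x → AdmitsNKernel (m + 1) g →
    ∀ {φ : X ⟶ K} {ψ : Y ⟶ L}, φ ≫ g = x ≫ ψ → ∃ s : Y ⟶ K, φ ≫ g = x ≫ s ≫ g := by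
  induction m with
  | zero =>
    rintro X Y K L x g ⟨W, y, hy, V, z, hz, -⟩ ⟨J, k, hk, hmono⟩ φ ψ h
    obtain ⟨φ₁, hφ₁⟩ := hk.2 (y ≫ φ)
      (by rw [Category.assoc, h, ← Category.assoc, hy.1, zero_comp])
    obtain ⟨s₁, hs₁⟩ := hz.exists_eq_comp_of_mono k hφ₁.symm
    exact hy.exists_comp_eq hk s₁ (by rw [hφ₁, hs₁, Category.assoc])
  | succ m ih =>
    rintro X Y K L x g ⟨W, y, hy, hy'⟩ ⟨J, k, hk, hk'⟩ φ ψ h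
    obtain ⟨φ₁, hφ₁⟩ := hk.2 (y ≫ φ)
      (by rw [Category.assoc, h, ← Category.assoc, hy.1, zero_comp])
    obtain ⟨s₁, hs₁⟩ := ih hy' hk' hφ₁.symm
    exact hy.exists_comp_eq hk s₁ (hφ₁.trans hs₁)

/-- If `f` has a weak cokernel `y` that in turn has a von Neumann regular weak cokernel, then
the weak cokernel `y` can be replaced by an epimorphism. -/
theorem IsWeakCokernel.admitsNCokernel_one_of_regular [IsIdempotentComplete C]
    {A B X Y : C} {f : A ⟶ B} {y : B ⟶ X} {x : X ⟶ Y} (hf : IsWeakCokernel f y)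
    (hy : IsWeakCokernel y x) {s : Y ⟶ X} (hs : x = x ≫ s ≫ x) : AdmitsNCokernel 1 f := by
  have idem : (𝟙 X - x ≫ s) ≫ (𝟙 X - x ≫ s) = 𝟙 X - x ≫ s := by
    have : x ≫ s ≫ x ≫ s = x ≫ s := by
      conv_rhs => rw [hs]
      simp only [Category.assoc]
    simp [Preadditive.comp_sub, Preadditive.sub_comp, this]
  obtain ⟨J, j, q, hjq, hqj⟩ := IsIdempotentComplete.idempotents_split X _ idem
  have hyq : y ≫ q ≫ j = y := by
    rw [hqj, Preadditive.comp_sub, Category.comp_id, ← Category.assoc, hy.1, zero_comp, sub_zero]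
  have hjx : j ≫ x = 0 := by
    have : q ≫ j ≫ x = 0 := by
      rw [← Category.assoc, hqj, Preadditive.sub_comp, Category.id_comp, Category.assoc, ← hs,
        sub_self]
    rw [← Category.id_comp (j ≫ x), ← hjq, Category.assoc, this, comp_zero]
  refine ⟨J, y ≫ q, ⟨?_, fun Z g hg => ?_⟩, Preadditive.epi_of_cancel_zero _ fun g hg => ?_⟩
  · rw [← Category.assoc, hf.1, zero_comp]
  · obtain ⟨h, hh⟩ := hf.2 g hg
    refine ⟨j ≫ h, ?_⟩
    rw [hh]
    conv_lhs => rw [← hyq]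
    simp only [Category.assoc]
  · obtain ⟨h, hh⟩ := hy.2 (q ≫ g) (by rw [← Category.assoc, hg])
    rw [← Category.id_comp g, ← hjq, Category.assoc, hh, ← Category.assoc, hjx, zero_comp]

theorem IsIteratedWeakCokernel.admitsNCokernel [IsIdempotentComplete C]
    (hwc : ∀ ⦃A B : C⦄ (f : A ⟶ B), ∃ (K : C) (w : B ⟶ K), IsWeakCokernel f w) (m : ℕ) :
    ∀ {k : ℕ}, (∀ ⦃A B : C⦄ (f : A ⟶ B), AdmitsNKernel (k + m + 1) f) →
    ∀ {A B : C} {f : A ⟶ B}, IsIteratedWeakCokernel k f → AdmitsNCokernel (m + 1) f := by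
  induction m with
  | zero =>
    intro k hnk A B f hf
    obtain ⟨X, y, hy⟩ := hwc f
    obtain ⟨Y, x, hx⟩ := hwc y
    obtain ⟨s, hs⟩ := AdmitsNKernel.exists_comp_eq k (x := x) (g := x) ⟨_, y, hx, _, f, hy, hf⟩
      (hnk x) (φ := 𝟙 X) (ψ := 𝟙 Y) (by simp)
    exact hy.admitsNCokernel_one_of_regular hx (by simpa using hs)
  | succ m ih =>
    intro k hnk A B f hf
    obtain ⟨X, y, hy⟩ := hwc f
    refine ⟨X, y, hy, ih (k := k + 1) (fun A B g => ?_) ⟨_, f, hy, hf⟩⟩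
    have := hnk g
    rwa [show k + (m + 1) + 1 = k + 1 + m + 1 by omega] at this

theorem hasNCokernels_of_hasNKernels [IsIdempotentComplete C]
    (hwc : ∀ ⦃A B : C⦄ (f : A ⟶ B), ∃ (K : C) (w : B ⟶ K), IsWeakCokernel f w) (m : ℕ)
    (hnk : ∀ ⦃A B : C⦄ (f : A ⟶ B), AdmitsNKernel (m + 1) f) ⦃A B : C⦄ (f : A ⟶ B) :
    AdmitsNCokernel (m + 1) f :=
  IsIteratedWeakCokernel.admitsNCokernel hwc m (k := 0) (by simpa using hnk) trivial

theorem IsWeakKernel.op {K A B : C} {w : K ⟶ A} {f : A ⟶ B} (h : IsWeakKernel w f) :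
    IsWeakCokernel f.op w.op := by
  refine ⟨by rw [← op_comp, h.1, op_zero], fun X g hg => ?_⟩
  obtain ⟨t, ht⟩ := h.2 g.unop (by rw [← Quiver.Hom.unop_op f, ← unop_comp, hg, unop_zero])
  exact ⟨t.op, Quiver.Hom.unop_inj ht⟩

theorem IsWeakCokernel.op {A B K : C} {f : A ⟶ B} {w : B ⟶ K} (h : IsWeakCokernel f w) :
    IsWeakKernel w.op f.op := by
  refine ⟨by rw [← op_comp, h.1, op_zero], fun X g hg => ?_⟩
  obtain ⟨t, ht⟩ := h.2 g.unop (by rw [← Quiver.Hom.unop_op f, ← unop_comp, hg, unop_zero])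
  exact ⟨t.op, Quiver.Hom.unop_inj ht⟩

theorem IsWeakCokernel.unop {A B K : Cᵒᵖ} {f : A ⟶ B} {w : B ⟶ K} (h : IsWeakCokernel f w) :
    IsWeakKernel w.unop f.unop := by
  refine ⟨by rw [← unop_comp, h.1, unop_zero], fun X g hg => ?_⟩
  obtain ⟨t, ht⟩ := h.2 g.op (by rw [← Quiver.Hom.op_unop f, ← op_comp, hg, op_zero])
  exact ⟨t.unop, Quiver.Hom.op_inj ht⟩

theorem AdmitsNCokernel.op (m : ℕ) : ∀ {A B : C} {f : A ⟶ B}, AdmitsNCokernel (m + 1) f →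
    AdmitsNKernel (m + 1) f.op := by
  induction m with
  | zero =>
    rintro A B f ⟨K, w, hw, _⟩
    exact ⟨.op K, w.op, hw.op, inferInstance⟩
  | succ m ih =>
    rintro A B f ⟨K, w, hw, hw'⟩
    exact ⟨.op K, w.op, hw.op, ih hw'⟩

theorem AdmitsNCokernel.unop (m : ℕ) : ∀ {A B : Cᵒᵖ} {f : A ⟶ B}, AdmitsNCokernel (m + 1) f →
    AdmitsNKernel (m + 1) f.unop := by
  induction m with
  | zero =>
    rintro A B f ⟨K, w, hw, _⟩
    exact ⟨K.unop, w.unop, hw.unop, inferInstance⟩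
  | succ m ih =>
    rintro A B f ⟨K, w, hw, hw'⟩
    exact ⟨K.unop, w.unop, hw.unop, ih hw'⟩

/-- **Theorem 1.** If `C` is an idempotent complete preadditive category that has weak
kernels and weak cokernels, and `n ≥ 1`, then `C` has `n`-kernels if and only if `C` has
`n`-cokernels. -/
theorem hasNKernels_iff_hasNCokernels
    [IsIdempotentComplete C]
    (hwk : ∀ ⦃A B : C⦄ (f : A ⟶ B), ∃ (K : C) (w : K ⟶ A), IsWeakKernel w f)
    (hwc : ∀ ⦃A B : C⦄ (f : A ⟶ B), ∃ (K : C) (w : B ⟶ K), IsWeakCokernel f w)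
    (n : ℕ) (hn : 1 ≤ n) :
    (∀ ⦃A B : C⦄ (f : A ⟶ B), AdmitsNKernel n f) ↔
      (∀ ⦃A B : C⦄ (f : A ⟶ B), AdmitsNCokernel n f) := by
  obtain ⟨m, rfl⟩ := Nat.exists_eq_add_of_le' hn
  refine ⟨hasNCokernels_of_hasNKernels hwc m, fun h A B f => ?_⟩
  refine AdmitsNCokernel.unop m (hasNCokernels_of_hasNKernels (C := Cᵒᵖ) (fun X Y g => ?_) m
    (fun X Y g => (h g.unop).op) f.op)
  obtain ⟨K, w, hw⟩ := hwk g.unop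
  exact ⟨.op K, w.op, hw.op⟩
end

section
/- Let C be an idempotent complete preadditive category that has weak kernels and weak cokernels. Then C has 0-kernels if and only if C has 0-cokernels. -/
/-!
STATEMENT 1: Let `C` be an idempotent complete preadditive category that has weak kernels
and weak cokernels. Then `C` has `0`-kernels if and only if `C` has `0`-cokernels.
-/

open CategoryTheory CategoryTheory.Limits

universe v u

variable {C : Type u} [Category.{v} C] [Preadditive C]

/-- `f : A ⟶ B` admits a `0`-kernel: there is a monomorphism `m : I ⟶ B` with
`f = m ∘ e` for some split epimorphism `e : A ⟶ I` (with section `s`, `e ∘ s = 1`). -/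
def Admits0Kernel {A B : C} (f : A ⟶ B) : Prop :=
  ∃ (I : C) (e : A ⟶ I) (m : I ⟶ B) (s : I ⟶ A),
    Mono m ∧ f = e ≫ m ∧ s ≫ e = 𝟙 I

/-- `f : A ⟶ B` admits a `0`-cokernel: there is an epimorphism `e : A ⟶ I` with
`f = m ∘ e` for some split monomorphism `m : I ⟶ B` (with retraction `r`, `r ∘ m = 1`). -/
def Admits0Cokernel {A B : C} (f : A ⟶ B) : Prop :=
  ∃ (I : C) (e : A ⟶ I) (m : I ⟶ B) (r : B ⟶ I),
    Epi e ∧ f = e ≫ m ∧ m ≫ r = 𝟙 I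

/-- A morphism admits a `0`-cokernel as soon as it has a weak cokernel which admits a
`0`-kernel. -/
theorem IsWeakCokernel.admits0Cokernel [IsIdempotentComplete C] {A B K : C} {f : A ⟶ B}
    {w : B ⟶ K} (hw : IsWeakCokernel f w) (h : Admits0Kernel w) : Admits0Cokernel f := by
  obtain ⟨J, e, m, s, hm, rfl, hse⟩ := h
  obtain ⟨hfw, hfac⟩ := hw
  have hfe : f ≫ e = 0 := by
    rw [← cancel_mono m, Category.assoc, hfw, zero_comp]
  have hp : (𝟙 B - e ≫ s) ≫ (𝟙 B - e ≫ s) = 𝟙 B - e ≫ s := by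
    simp [Preadditive.comp_sub, Preadditive.sub_comp, reassoc_of% hse]
  obtain ⟨I, i, r, hir, hri⟩ := IsIdempotentComplete.idempotents_split B _ hp
  have hie : i ≫ e = 0 := by
    have hre : r ≫ i ≫ e = 0 := by
      rw [← Category.assoc, hri]
      simp [Preadditive.sub_comp, hse]
    rw [← Category.id_comp (i ≫ e), ← hir, Category.assoc, hre, comp_zero]
  refine ⟨I, f ≫ r, i, r, ?_, ?_, hir⟩
  · refine Preadditive.epi_of_cancel_zero _ fun g hg => ?_
    obtain ⟨t, ht⟩ := hfac (r ≫ g) (by rw [← Category.assoc, hg])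
    rw [← Category.id_comp g, ← hir, Category.assoc, ht]
    simp [reassoc_of% hie]
  · rw [Category.assoc, hri]
    simp [Preadditive.comp_sub, reassoc_of% hfe]

/-- A morphism admits a `0`-kernel as soon as it has a weak kernel which admits a
`0`-cokernel. -/
theorem IsWeakKernel.admits0Kernel [IsIdempotentComplete C] {K A B : C} {w : K ⟶ A}
    {f : A ⟶ B} (hw : IsWeakKernel w f) (h : Admits0Cokernel w) : Admits0Kernel f := by
  obtain ⟨J, e, m, s, he, rfl, hms⟩ := h
  obtain ⟨hwf, hfac⟩ := hw
  have hmf : m ≫ f = 0 := by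
    rw [← cancel_epi e, ← Category.assoc, hwf, comp_zero]
  have hp : (𝟙 A - s ≫ m) ≫ (𝟙 A - s ≫ m) = 𝟙 A - s ≫ m := by
    simp [Preadditive.comp_sub, Preadditive.sub_comp, reassoc_of% hms]
  obtain ⟨I, i, r, hir, hri⟩ := IsIdempotentComplete.idempotents_split A _ hp
  have hmr : m ≫ r = 0 := by
    have hmri : (m ≫ r) ≫ i = 0 := by
      rw [Category.assoc, hri]
      simp [Preadditive.comp_sub, reassoc_of% hms]
    rw [← Category.comp_id (m ≫ r), ← hir, ← Category.assoc, hmri, zero_comp]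
  refine ⟨I, r, i ≫ f, i, ?_, ?_, hir⟩
  · refine Preadditive.mono_of_cancel_zero _ fun g hg => ?_
    obtain ⟨t, ht⟩ := hfac (g ≫ i) (by rw [Category.assoc, hg])
    rw [← Category.comp_id g, ← hir, ← Category.assoc, ht]
    simp [hmr]
  · rw [← Category.assoc, hri]
    simp [Preadditive.sub_comp, hmf]

/-- If `C` is an idempotent complete preadditive category that has weak kernels and weak
cokernels, then `C` has `0`-kernels if and only if `C` has `0`-cokernels. -/
theorem has0Kernels_iff_has0Cokernels
    [IsIdempotentComplete C]
    (hwk : ∀ ⦃A B : C⦄ (f : A ⟶ B), ∃ (K : C) (w : K ⟶ A), IsWeakKernel w f)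
    (hwc : ∀ ⦃A B : C⦄ (f : A ⟶ B), ∃ (K : C) (w : B ⟶ K), IsWeakCokernel f w) :
    (∀ ⦃A B : C⦄ (f : A ⟶ B), Admits0Kernel f) ↔
      (∀ ⦃A B : C⦄ (f : A ⟶ B), Admits0Cokernel f) := by
  refine ⟨fun h A B f => ?_, fun h A B f => ?_⟩
  · obtain ⟨K, w, hw⟩ := hwc f
    exact hw.admits0Cokernel (h w)
  · obtain ⟨K, w, hw⟩ := hwk f
    exact hw.admits0Kernel (h w)
end

section
/- Let C be an idempotent complete preadditive category and n ≥ 1. Let a₀ : A₀ → A₁ be a morphism, let aᵢ : Aᵢ → Aᵢ₊₁ (for 1 ≤ i ≤ n+1) be morphisms such that aᵢ is a weak cokernel of aᵢ₋₁ for each 1 ≤ i ≤ n+1, and let B₁ →^{b₁} ⋯ →^{b_{n−1}} Bₙ →^{bₙ} A_{n+1} be an n-kernel of a_{n+1}. Then there exist an object C' and a morphism q : Aₙ → C' such that q is a cokernel of a_{n−1} and the sequence A₁ →^{a₁} A₂ →^{a₂} ⋯ →^{a_{n−1}} Aₙ →^{q} C' is an n-cokernel of a₀. In particular, a₀ admits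 an n-cokernel. -/
/-!
STATEMENT 2: Let `C` be an idempotent complete preadditive category and `n ≥ 1`.
Given `a₀ : A₀ ⟶ A₁` and morphisms `aᵢ : Aᵢ ⟶ Aᵢ₊₁` (`1 ≤ i ≤ n+1`) with `aᵢ` a weak
cokernel of `aᵢ₋₁` for each `1 ≤ i ≤ n+1`, and an `n`-kernel
`B₁ ⟶ ⋯ ⟶ Bₙ ⟶ A_{n+1}` of `a_{n+1}`, there exist an object `C'` and a morphism
`q : Aₙ ⟶ C'` such that `q` is a cokernel of `a_{n−1}` and the sequence
`A₁ ⟶ A₂ ⟶ ⋯ ⟶ Aₙ ⟶ C'` (with last map `q`) is an `n`-cokernel of `a₀`.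
In particular, `a₀` admits an `n`-cokernel.

Encoding: the integer `n ≥ 1` is written as `n = m + 1` with `m : ℕ` arbitrary (so that
index arithmetic stays definitional).  Sequences of objects and morphisms are encoded as
`ℕ`-indexed families; only the indices occurring in the hypotheses/conclusions are
constrained.  The `n`-kernel `B₁ ⟶ ⋯ ⟶ Bₙ ⟶ A_{n+1}` is encoded by inner morphisms
`b i : B i ⟶ B (i+1)` (used for `1 ≤ i ≤ n−1`) with the last one given separately as
`bn : B n ⟶ A (n+1)`: `bn` is a weak kernel of `a (n+1)`, `b i` is a weak kernel of
`b (i+1)` for `1 ≤ i ≤ n−2`, `b (n−1)` is a weak kernel of `bn` (when `n ≥ 2`), and the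
first morphism of the chain (`bn` if `n = 1`, `b 1` if `n ≥ 2`) is a monomorphism.
-/

open CategoryTheory CategoryTheory.Limits

universe v u

variable {C : Type u} [Category.{v} C] [Preadditive C]

/-- `q : B ⟶ Q` is a cokernel of `f : A ⟶ B`: `f ≫ q = 0` and every `v : B ⟶ X` with
`f ≫ v = 0` factors uniquely through `q`. -/
def IsCokernel {A B Q : C} (f : A ⟶ B) (q : B ⟶ Q) : Prop :=
  f ≫ q = 0 ∧ ∀ ⦃X : C⦄ (v : B ⟶ X), f ≫ v = 0 → ∃! h : Q ⟶ X, v = q ≫ h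

/-- The condition on `f`, `g`, `β` that is propagated along an `n`-kernel: every `t` with
`f ≫ t ≫ β = 0` agrees with a multiple of `g` after composing with `β`. -/
def FactorsModulo {X Y Z K L : C} (f : X ⟶ Y) (g : Y ⟶ Z) (β : K ⟶ L) : Prop :=
  ∀ t : Y ⟶ K, f ≫ t ≫ β = 0 → ∃ h : Z ⟶ K, t ≫ β = g ≫ h ≫ β

lemma IsWeakCokernel.factorsModulo_of_mono {X Y Z K L : C} {f : X ⟶ Y} {g : Y ⟶ Z}
    (hg : IsWeakCokernel f g) (β : K ⟶ L) [Mono β] : FactorsModulo f g β := by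
  intro t ht
  obtain ⟨h, rfl⟩ := hg.2 t (by rwa [← cancel_mono β, zero_comp, Category.assoc])
  exact ⟨h, by simp⟩

lemma FactorsModulo.step {X Y Z W K L M : C} {f : X ⟶ Y} {g : Y ⟶ Z} {g' : Z ⟶ W}
    {β : K ⟶ L} {β' : L ⟶ M} (hP : FactorsModulo f g β) (hfg : f ≫ g = 0)
    (hg' : IsWeakCokernel g g') (hβ : IsWeakKernel β β') : FactorsModulo g g' β' := by
  intro t ht
  obtain ⟨s, hs⟩ := hβ.2 (g ≫ t) (by simpa using ht)
  obtain ⟨h, hh⟩ := hP s (by rw [← hs, reassoc_of% hfg, zero_comp])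
  obtain ⟨h', hh'⟩ := hg'.2 (t - h ≫ β) (by rw [Preadditive.comp_sub, hs, hh, sub_self])
  refine ⟨h', ?_⟩
  rw [← Category.assoc, ← hh', Preadditive.sub_comp, Category.assoc, hβ.1, comp_zero, sub_zero]

/-- Let `g` and `k` be successive weak cokernels of `f`, and `β` a weak kernel of `k` such that
`FactorsModulo f g β`. Then `f` has an epimorphic weak cokernel. -/
lemma FactorsModulo.exists_cokernel [IsIdempotentComplete C] {X Y Z W K : C} {f : X ⟶ Y}
    {g : Y ⟶ Z} {k : Z ⟶ W} {β : K ⟶ Z} (hP : FactorsModulo f g β)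
    (hg : IsWeakCokernel f g) (hk : IsWeakCokernel g k) (hβ : IsWeakKernel β k) :
    ∃ (Q : C) (q : Y ⟶ Q), IsWeakCokernel f q ∧ Epi q := by
  obtain ⟨p, hp⟩ := hβ.2 g hk.1
  obtain ⟨h, hh⟩ := hP p (by rw [← hp, hg.1])
  rw [← hp] at hh
  obtain ⟨l, hl⟩ := hk.2 (𝟙 Z - h ≫ β) (by simp [Preadditive.comp_sub, ← hh])
  have hβh : β ≫ h ≫ β = β := by
    have := congrArg (fun x => β ≫ x) hl
    simp only [reassoc_of% hβ.1, zero_comp, Preadditive.comp_sub, Category.comp_id,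
      sub_eq_zero] at this
    exact this.symm
  obtain ⟨I, ι, r, hιr, hrι⟩ := IsIdempotentComplete.idempotents_split Z (h ≫ β)
    (by rw [Category.assoc, hβh])
  have hιk : ι ≫ k = 0 := by
    have : ι = ι ≫ h ≫ β := by rw [← hrι, reassoc_of% hιr]
    rw [this, Category.assoc, Category.assoc, hβ.1, comp_zero, comp_zero]
  refine ⟨I, g ≫ r, ⟨by rw [reassoc_of% hg.1, zero_comp], fun V v hv => ?_⟩,
    Preadditive.epi_of_cancel_zero _ fun {V} v hv => ?_⟩
  · obtain ⟨v', rfl⟩ := hg.2 v hv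
    refine ⟨ι ≫ v', ?_⟩
    rw [Category.assoc, reassoc_of% hrι, ← Category.assoc h, ← Category.assoc g, ← hh]
  · obtain ⟨w, hw⟩ := hk.2 (r ≫ v) (by simpa using hv)
    rw [← Category.id_comp v, ← hιr, Category.assoc, hw, reassoc_of% hιk, zero_comp]

lemma IsWeakCokernel.isCokernel {X Y Q : C} {f : X ⟶ Y} {q : Y ⟶ Q}
    (hq : IsWeakCokernel f q) [Epi q] : IsCokernel f q := by
  refine ⟨hq.1, fun V v hv => ?_⟩
  obtain ⟨h, rfl⟩ := hq.2 v hv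
  exact ⟨h, rfl, fun h' hh' => ((cancel_epi q).1 hh').symm⟩

lemma admitsNCokernel_of_chain (m : ℕ) (A : ℕ → C) (a : ∀ i, A i ⟶ A (i + 1))
    (ha : ∀ i, i + 1 ≤ m → IsWeakCokernel (a i) (a (i + 1)))
    {Q : C} (q : A (m + 1) ⟶ Q) (hq : IsWeakCokernel (a m) q) (hepi : Epi q) :
    AdmitsNCokernel (m + 1) (a 0) := by
  induction m generalizing A with
  | zero => exact ⟨Q, q, hq, hepi⟩
  | succ m ih =>
    exact ⟨_, a 1, ha 0 (by omega), ih (fun i => A (i + 1)) (fun i => a (i + 1))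
      (fun i hi => ha (i + 1) (by omega)) q hq hepi⟩

/-- Statement 2, with `n = m + 1` (`m : ℕ` arbitrary, so `n` ranges over all integers
`≥ 1`). -/
theorem exists_nCokernel_of_nKernel
    [IsIdempotentComplete C] (m : ℕ)
    (A : ℕ → C) (a : ∀ i, A i ⟶ A (i + 1))
    -- `aᵢ` is a weak cokernel of `aᵢ₋₁` for `1 ≤ i ≤ n + 1 = m + 2`:
    (ha : ∀ i, i ≤ m + 1 → IsWeakCokernel (a i) (a (i + 1)))
    (B : ℕ → C) (b : ∀ i, B i ⟶ B (i + 1)) (bn : B (m + 1) ⟶ A (m + 2))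
    -- the chain `B₁ ⟶ ⋯ ⟶ B_{m+1} ⟶ A_{m+2}` is an `(m+1)`-kernel of `a_{m+2}`:
    (hbn : IsWeakKernel bn (a (m + 2)))
    (hb : ∀ i, 1 ≤ i → i + 2 ≤ m + 1 → IsWeakKernel (b i) (b (i + 1)))
    (hblast : 1 ≤ m → IsWeakKernel (b m) bn)
    (hmono₁ : m = 0 → Mono bn) (hmono₂ : 1 ≤ m → Mono (b 1)) :
    ∃ (Q : C) (q : A (m + 1) ⟶ Q),
      -- `q` is a cokernel of `a_{n-1} = a m`:
      IsCokernel (a m) q ∧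
      -- the sequence `A₁ ⟶ ⋯ ⟶ A_{m+1} ⟶ Q` with last map `q` is an
      -- `(m+1)`-cokernel of `a₀`:
      (∀ i, i + 1 ≤ m → IsWeakCokernel (a i) (a (i + 1))) ∧
      IsWeakCokernel (a m) q ∧ Epi q ∧
      -- in particular `a₀` admits an `(m+1)`-cokernel:
      AdmitsNCokernel (m + 1) (a 0) := by
  have hchain : ∀ j, j + 1 ≤ m → FactorsModulo (a j) (a (j + 1)) (b (j + 1)) := by
    intro j
    induction j with
    | zero =>
      intro hj
      have := hmono₂ hj
      exact (ha 0 (by omega)).factorsModulo_of_mono _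
    | succ j ih =>
      intro hj
      exact (ih (by omega)).step (ha j (by omega)).1 (ha (j + 1) (by omega))
        (hb (j + 1) (by omega) (by omega))
  have hlast : FactorsModulo (a m) (a (m + 1)) bn := by
    cases m with
    | zero =>
      have := hmono₁ rfl
      exact (ha 0 (by omega)).factorsModulo_of_mono _
    | succ m =>
      exact (hchain m le_rfl).step (ha m (by omega)).1 (ha (m + 1) (by omega))
        (hblast (by omega))
  obtain ⟨Q, q, hq, hepi⟩ :=
    hlast.exists_cokernel (ha m (by omega)) (ha (m + 1) le_rfl) hbn
  have hw : ∀ i, i + 1 ≤ m → IsWeakCokernel (a i) (a (i + 1)) := fun i hi => ha i (by omega)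
  exact ⟨Q, q, hq.isCokernel, hw, hq, hepi, admitsNCokernel_of_chain m A a hw q hq hepi⟩
end

section
/- Let C be a preadditive category and n ≥ 1. Let a₀ : A₀ → A₁ be a morphism, let aᵢ : Aᵢ → Aᵢ₊₁ (for 1 ≤ i ≤ n+1) be morphisms such that aᵢ is a weak cokernel of aᵢ₋₁ for each 1 ≤ i ≤ n+1, and let B₁ →^{b₁} ⋯ →^{b_{n−1}} Bₙ →^{bₙ} A_{n+1} be an n-kernel of a_{n+1}. Then: (i) there exist morphisms cᵢ : Aᵢ → Bᵢ for 1 ≤ i ≤ n such that, setting B_{n+1} := A_{n+1} and c_{n+1} := id_{A_{n+1}}, one has cᵢ₊₁ ∘ aᵢ = bᵢ ∘ cᵢ for all 1 ≤ i ≤ n; and (ii) for any such family (cᵢ), there exist morphisms dᵢ₊₁ : Aᵢ₊₁ → Bᵢ for 1 ≤ i ≤ n+1 such that c₁ = d₂ ∘ a₁ and cᵢ − bᵢ₋₁ ∘ dᵢ = dᵢ₊₁ ∘ aᵢ for all 2 ≤ i ≤ n+1. -/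
/-!
STATEMENT 3: Let `C` be a preadditive category and `n ≥ 1`.  Given `a₀ : A₀ ⟶ A₁`,
morphisms `aᵢ : Aᵢ ⟶ Aᵢ₊₁` (`1 ≤ i ≤ n+1`) with `aᵢ` a weak cokernel of `aᵢ₋₁`, and an
`n`-kernel `B₁ ⟶ ⋯ ⟶ Bₙ ⟶ A_{n+1}` of `a_{n+1}`, then:
(i) there exist `cᵢ : Aᵢ ⟶ Bᵢ` (`1 ≤ i ≤ n`) such that, with `B_{n+1} := A_{n+1}` and
`c_{n+1} := id`, one has `cᵢ₊₁ ∘ aᵢ = bᵢ ∘ cᵢ` for all `1 ≤ i ≤ n`; and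
(ii) for any such family `(cᵢ)`, there exist `dᵢ₊₁ : Aᵢ₊₁ ⟶ Bᵢ` (`1 ≤ i ≤ n+1`) with
`c₁ = d₂ ∘ a₁` and `cᵢ − bᵢ₋₁ ∘ dᵢ = dᵢ₊₁ ∘ aᵢ` for all `2 ≤ i ≤ n+1`.

Encoding: `n = m + 1` with `m : ℕ` arbitrary (so `n` ranges over all integers `≥ 1`).
Sequences are `ℕ`-indexed families, only the relevant indices being constrained; the last
morphism of the `n`-kernel is given separately as `bn : B n ⟶ A (n+1)`, and since
`B_{n+1} := A_{n+1}`, the morphisms `d_{i+1} : A_{i+1} ⟶ B_i` for `1 ≤ i ≤ n` form a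
family `d` with `d i : A (i+1) ⟶ B i`, while `d_{n+2} : A_{n+2} ⟶ B_{n+1} = A_{n+1}` is
given separately as `dtop`.  The paper's relations `cᵢ − bᵢ₋₁ ∘ dᵢ = dᵢ₊₁ ∘ aᵢ` for
`2 ≤ i ≤ n` are written with `i = j + 1`, `1 ≤ j ≤ n − 1`.
-/

open CategoryTheory CategoryTheory.Limits

universe v u

variable {C : Type u} [Category.{v} C] [Preadditive C]

/-- A morphism `f : A (k + 1) ⟶ B (k + 1)` extends downwards to a morphism of sequences ending
in `f`, provided that it extends one step and the `b i` are successive weak kernels. -/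
lemma exists_lift_below (A B : ℕ → C) (a : ∀ i, A i ⟶ A (i + 1)) (b : ∀ i, B i ⟶ B (i + 1))
    (k : ℕ) (ha : ∀ i, i + 1 ≤ k → a i ≫ a (i + 1) = 0)
    (hb : ∀ i, 1 ≤ i → i + 1 ≤ k → IsWeakKernel (b i) (b (i + 1)))
    (f : A (k + 1) ⟶ B (k + 1)) (hf : 1 ≤ k → ∃ g : A k ⟶ B k, a k ≫ f = g ≫ b k) :
    ∃ c : ∀ i, A i ⟶ B i, c (k + 1) = f ∧
      ∀ i, 1 ≤ i → i ≤ k → a i ≫ c (i + 1) = c i ≫ b i := by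
  induction k with
  | zero => exact ⟨Function.update (fun _ ↦ 0) 1 f, by simp, by omega⟩
  | succ k ih =>
    obtain ⟨g, hg⟩ := hf (by omega)
    obtain ⟨c, rfl, hc⟩ := ih (fun i hi ↦ ha i (by omega)) (fun i h hi ↦ hb i h (by omega)) g
      (fun hk ↦ (hb k hk le_rfl).2 _ (by
        rw [Category.assoc, ← hg, ← Category.assoc, ha k le_rfl, zero_comp]))
    refine ⟨Function.update c (k + 2) f, by simp, fun i h hi ↦ ?_⟩
    rw [Function.update_of_ne (by omega : i ≠ k + 2)]
    rcases Nat.le_succ_iff.mp hi with h' | rfl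
    · rw [Function.update_of_ne (by omega : i + 1 ≠ k + 2)]
      exact hc i h h'
    · simpa using hg

/-- The obstruction `c (k + 1) - a (k + 1) ≫ d (k + 1)` to a partial homotopy `d` becomes zero
after composition with any morphism annihilated by `b k`. -/
lemma partial_homotopy_comp {A B : ℕ → C} {a : ∀ i, A i ⟶ A (i + 1)}
    {b : ∀ i, B i ⟶ B (i + 1)} {c : ∀ i, A i ⟶ B i} {d : ∀ i, A (i + 1) ⟶ B i} {k : ℕ}
    (h₁ : c 1 = a 1 ≫ d 1)
    (hd : ∀ j, 1 ≤ j → j ≤ k → c (j + 1) - d j ≫ b j = a (j + 1) ≫ d (j + 1))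
    {Y : C} (y : B (k + 1) ⟶ Y) (hy : 1 ≤ k → b k ≫ y = 0) :
    a (k + 1) ≫ d (k + 1) ≫ y = c (k + 1) ≫ y := by
  rcases Nat.eq_zero_or_pos k with rfl | hk
  · rw [← Category.assoc]
    exact congrArg (· ≫ y) h₁.symm
  · rw [← Category.assoc, ← hd k hk le_rfl, Preadditive.sub_comp, Category.assoc, hy hk,
      comp_zero, sub_zero]

/-- A morphism of sequences `c` with `a 0 ≫ c 1 = 0` is null-homotopic in low degrees when the
`a i` are successive weak cokernels. -/
lemma exists_partial_homotopy (A B : ℕ → C) (a : ∀ i, A i ⟶ A (i + 1))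
    (b : ∀ i, B i ⟶ B (i + 1)) (c : ∀ i, A i ⟶ B i) (m : ℕ)
    (ha : ∀ i, i ≤ m → IsWeakCokernel (a i) (a (i + 1)))
    (hb : ∀ i, 1 ≤ i → i + 1 ≤ m → b i ≫ b (i + 1) = 0)
    (h₀ : a 0 ≫ c 1 = 0)
    (hc : ∀ i, 1 ≤ i → i ≤ m → a i ≫ c (i + 1) = c i ≫ b i) :
    ∃ d : ∀ i, A (i + 1) ⟶ B i, c 1 = a 1 ≫ d 1 ∧
      ∀ j, 1 ≤ j → j ≤ m → c (j + 1) - d j ≫ b j = a (j + 1) ≫ d (j + 1) := by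
  induction m with
  | zero =>
    obtain ⟨e, he⟩ := (ha 0 le_rfl).2 _ h₀
    exact ⟨Function.update (fun _ ↦ 0) 1 e, by simpa using he, by omega⟩
  | succ k ih =>
    obtain ⟨d, h₁, hd⟩ := ih (fun i hi ↦ ha i (by omega)) (fun i h hi ↦ hb i h (by omega))
      (fun i h hi ↦ hc i h (by omega))
    obtain ⟨e, he⟩ := (ha (k + 1) le_rfl).2 (c (k + 2) - d (k + 1) ≫ b (k + 1)) (by
      rw [Preadditive.comp_sub, hc (k + 1) (by omega) le_rfl,
        partial_homotopy_comp h₁ hd _ (fun h ↦ hb k h le_rfl), sub_self])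
    refine ⟨Function.update d (k + 2) e, ?_, fun j h hj ↦ ?_⟩
    · rwa [Function.update_of_ne (by omega : 1 ≠ k + 2)]
    · rw [Function.update_of_ne (by omega : j ≠ k + 2)]
      rcases Nat.le_succ_iff.mp hj with h' | rfl
      · rw [Function.update_of_ne (by omega : j + 1 ≠ k + 2)]
        exact hd j h h'
      · simpa using he

/-- Statement 3, with `n = m + 1` (`m : ℕ` arbitrary, so `n` ranges over all integers
`≥ 1`). -/
theorem exists_comparison_maps
    (m : ℕ)
    (A : ℕ → C) (a : ∀ i, A i ⟶ A (i + 1))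
    -- `aᵢ` is a weak cokernel of `aᵢ₋₁` for `1 ≤ i ≤ n + 1 = m + 2`:
    (ha : ∀ i, i ≤ m + 1 → IsWeakCokernel (a i) (a (i + 1)))
    (B : ℕ → C) (b : ∀ i, B i ⟶ B (i + 1)) (bn : B (m + 1) ⟶ A (m + 2))
    -- the chain `B₁ ⟶ ⋯ ⟶ B_{m+1} ⟶ A_{m+2}` is an `(m+1)`-kernel of `a_{m+2}`:
    (hbn : IsWeakKernel bn (a (m + 2)))
    (hb : ∀ i, 1 ≤ i → i + 2 ≤ m + 1 → IsWeakKernel (b i) (b (i + 1)))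
    (hblast : 1 ≤ m → IsWeakKernel (b m) bn)
    (hmono₁ : m = 0 → Mono bn) (hmono₂ : 1 ≤ m → Mono (b 1)) :
    -- (i): existence of the comparison maps `cᵢ`:
    (∃ c : ∀ i, A i ⟶ B i,
      a (m + 1) = c (m + 1) ≫ bn ∧
      ∀ i, 1 ≤ i → i ≤ m → a i ≫ c (i + 1) = c i ≫ b i) ∧
    -- (ii): for any such family `(cᵢ)`, existence of the maps `dᵢ₊₁`:
    (∀ c : ∀ i, A i ⟶ B i,
      a (m + 1) = c (m + 1) ≫ bn →
      (∀ i, 1 ≤ i → i ≤ m → a i ≫ c (i + 1) = c i ≫ b i) →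
      ∃ (d : ∀ i, A (i + 1) ⟶ B i) (dtop : A (m + 3) ⟶ A (m + 2)),
        c 1 = a 1 ≫ d 1 ∧
        (∀ j, 1 ≤ j → j ≤ m → c (j + 1) - d j ≫ b j = a (j + 1) ≫ d (j + 1)) ∧
        𝟙 (A (m + 2)) - d (m + 1) ≫ bn = a (m + 2) ≫ dtop) := by
  refine ⟨?_, fun c hcn hc ↦ ?_⟩
  · obtain ⟨f, hf⟩ := hbn.2 _ (ha (m + 1) le_rfl).1
    obtain ⟨c, rfl, hc⟩ := exists_lift_below A B a b m (fun i hi ↦ (ha i (by omega)).1)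
      (fun i h hi ↦ hb i h (by omega)) f
      (fun hm ↦ (hblast hm).2 _ (by rw [Category.assoc, ← hf, (ha m (by omega)).1]))
    exact ⟨c, hf, hc⟩
  · have h₀ : a 0 ≫ c 1 = 0 := by
      rcases Nat.eq_zero_or_pos m with rfl | hm
      · have := hmono₁ rfl
        rw [← cancel_mono bn, Category.assoc, ← hcn, (ha 0 (by omega)).1, zero_comp]
      · have := hmono₂ hm
        rw [← cancel_mono (b 1), Category.assoc, ← hc 1 le_rfl hm, ← Category.assoc,
          (ha 0 (by omega)).1, zero_comp, zero_comp]
    have hbb : ∀ i, 1 ≤ i → i + 1 ≤ m → b i ≫ b (i + 1) = 0 :=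
      fun i h hi ↦ (hb i h (by omega)).1
    obtain ⟨d, h₁, hd⟩ :=
      exists_partial_homotopy A B a b c m (fun i hi ↦ ha i (by omega)) hbb h₀ hc
    obtain ⟨e, he⟩ := (ha (m + 1) le_rfl).2 (𝟙 (A (m + 2)) - d (m + 1) ≫ bn) (by
      rw [Preadditive.comp_sub, partial_homotopy_comp h₁ hd _ (fun h ↦ (hblast h).1), ← hcn,
        Category.comp_id, sub_self])
    exact ⟨d, e, h₁, hd, he⟩
end

section
/- Let C be an idempotent complete preadditive category and n ≥ 1. Let a₀ : A₀ → A₁ be a morphism, let aᵢ : Aᵢ → Aᵢ₊₁ (for 1 ≤ i ≤ n+1) be morphisms such that aᵢ is a weak cokernel of aᵢ₋₁ for each 1 ≤ i ≤ n+1, and let B₁ →^{b₁} ⋯ →^{b_{n−1}} Bₙ →^{bₙ} A_{n+1} be an n-kernel of a_{n+1}. Suppose cᵢ : Aᵢ → Bᵢ (1 ≤ i ≤ n, with B_{n+1} := A_{n+1} and c_{n+1} := id) satisfy cᵢ₊₁ ∘ aᵢ = bᵢ ∘ cᵢ for 1 ≤ i ≤ n, and dᵢ₊₁ : Aᵢ₊₁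 → Bᵢ (1 ≤ i ≤ n+1) satisfy c₁ = d₂ ∘ a₁ and cᵢ − bᵢ₋₁ ∘ dᵢ = dᵢ₊₁ ∘ aᵢ for 2 ≤ i ≤ n+1. Then bₙ = bₙ ∘ d_{n+1} ∘ bₙ, so d_{n+1} ∘ bₙ : Bₙ → Bₙ is idempotent; and if f : C' → Bₙ and g : Bₙ → C' are morphisms with f ∘ g = d_{n+1} ∘ bₙ and g ∘ f = 1, then g ∘ cₙ : Aₙ → C' is a cokernel of a_{n−1}. -/
/-!
STATEMENT 4: Let `C` be an idempotent complete preadditive category and `n ≥ 1`.  With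
the data of Statement 3 (the chain `(aᵢ)` of weak cokernels, the `n`-kernel
`B₁ ⟶ ⋯ ⟶ Bₙ ⟶ A_{n+1}` of `a_{n+1}`, the comparison maps `(cᵢ)` and the maps `(dᵢ)`),
one has `bₙ = bₙ ∘ d_{n+1} ∘ bₙ`, so `d_{n+1} ∘ bₙ : Bₙ ⟶ Bₙ` is idempotent; and if
`f : C' ⟶ Bₙ` and `g : Bₙ ⟶ C'` satisfy `f ∘ g = d_{n+1} ∘ bₙ` and `g ∘ f = 1`, then
`g ∘ cₙ : Aₙ ⟶ C'` is a cokernel of `a_{n−1}`.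

Encoding: `n = m + 1` with `m : ℕ` arbitrary (so `n` ranges over all integers `≥ 1`);
sequences are `ℕ`-indexed families, only the relevant indices being constrained.  The
last morphism of the `n`-kernel is `bn : B (m+1) ⟶ A (m+2)`; with `B_{n+1} := A_{n+1}`
and `c_{n+1} := id`, the family `c` satisfies `cᵢ₊₁ ∘ aᵢ = bᵢ ∘ cᵢ` (`1 ≤ i ≤ n`); the
maps `d i : A (i+1) ⟶ B i` encode the paper's `d_{i+1}` for `1 ≤ i ≤ n`, and
`dtop : A (n+2) ⟶ A (n+1)` encodes `d_{n+2}`; they satisfy `c₁ = d₂ ∘ a₁` and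
`cᵢ − bᵢ₋₁ ∘ dᵢ = dᵢ₊₁ ∘ aᵢ` for `2 ≤ i ≤ n+1`.
-/

open CategoryTheory CategoryTheory.Limits

universe v u

variable {C : Type u} [Category.{v} C] [Preadditive C]

/-- Statement 4, with `n = m + 1` (`m : ℕ` arbitrary, so `n` ranges over all integers
`≥ 1`). -/
theorem cokernel_from_idempotent_splitting
    [IsIdempotentComplete C] (m : ℕ)
    (A : ℕ → C) (a : ∀ i, A i ⟶ A (i + 1))
    -- `aᵢ` is a weak cokernel of `aᵢ₋₁` for `1 ≤ i ≤ n + 1 = m + 2`: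
    (ha : ∀ i, i ≤ m + 1 → IsWeakCokernel (a i) (a (i + 1)))
    (B : ℕ → C) (b : ∀ i, B i ⟶ B (i + 1)) (bn : B (m + 1) ⟶ A (m + 2))
    -- the chain `B₁ ⟶ ⋯ ⟶ B_{m+1} ⟶ A_{m+2}` is an `(m+1)`-kernel of `a_{m+2}`:
    (hbn : IsWeakKernel bn (a (m + 2)))
    (hb : ∀ i, 1 ≤ i → i + 2 ≤ m + 1 → IsWeakKernel (b i) (b (i + 1)))
    (hblast : 1 ≤ m → IsWeakKernel (b m) bn)
    (hmono₁ : m = 0 → Mono bn) (hmono₂ : 1 ≤ m → Mono (b 1))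
    -- the comparison maps `cᵢ` (with `c_{n+1} = id`):
    (c : ∀ i, A i ⟶ B i)
    (hc₁ : a (m + 1) = c (m + 1) ≫ bn)
    (hc₂ : ∀ i, 1 ≤ i → i ≤ m → a i ≫ c (i + 1) = c i ≫ b i)
    -- the maps `dᵢ₊₁` (where `d i` is the paper's `d_{i+1}` and `dtop` is `d_{n+2}`):
    (d : ∀ i, A (i + 1) ⟶ B i) (dtop : A (m + 3) ⟶ A (m + 2))
    (hd₁ : c 1 = a 1 ≫ d 1)
    (hd₂ : ∀ j, 1 ≤ j → j ≤ m → c (j + 1) - d j ≫ b j = a (j + 1) ≫ d (j + 1))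
    (hd₃ : 𝟙 (A (m + 2)) - d (m + 1) ≫ bn = a (m + 2) ≫ dtop) :
    -- `bₙ = bₙ ∘ d_{n+1} ∘ bₙ`, so `d_{n+1} ∘ bₙ` is idempotent:
    bn = bn ≫ d (m + 1) ≫ bn ∧
    (bn ≫ d (m + 1)) ≫ bn ≫ d (m + 1) = bn ≫ d (m + 1) ∧
    -- for any splitting `f, g` of the idempotent `d_{n+1} ∘ bₙ`, the morphism
    -- `g ∘ cₙ : Aₙ ⟶ C'` is a cokernel of `a_{n−1}`:
    ∀ (C' : C) (f : C' ⟶ B (m + 1)) (g : B (m + 1) ⟶ C'),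
      g ≫ f = bn ≫ d (m + 1) → f ≫ g = 𝟙 C' →
      IsCokernel (a m) (c (m + 1) ≫ g) := by
  have hreg : bn = bn ≫ d (m + 1) ≫ bn := by
    have h : bn ≫ (𝟙 (A (m + 2)) - d (m + 1) ≫ bn) = 0 := by
      rw [hd₃, ← Category.assoc, hbn.1, zero_comp]
    rwa [Preadditive.comp_sub, Category.comp_id, sub_eq_zero] at h
  have hidem : (bn ≫ d (m + 1)) ≫ bn ≫ d (m + 1) = bn ≫ d (m + 1) := by
    have h := congrArg (fun x => x ≫ d (m + 1)) hreg
    simpa only [Category.assoc] using h.symm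
  refine ⟨hreg, hidem, fun C' f g hgf hfg => ?_⟩
  have hg : g = bn ≫ d (m + 1) ≫ g := by
    calc g = g ≫ f ≫ g := by rw [hfg, Category.comp_id]
      _ = (g ≫ f) ≫ g := (Category.assoc _ _ _).symm
      _ = bn ≫ d (m + 1) ≫ g := by rw [hgf, Category.assoc]
  have hq : c (m + 1) ≫ g = a (m + 1) ≫ d (m + 1) ≫ g := by
    calc c (m + 1) ≫ g = c (m + 1) ≫ bn ≫ d (m + 1) ≫ g := by rw [← hg]
      _ = a (m + 1) ≫ d (m + 1) ≫ g := by rw [hc₁, Category.assoc]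
  refine ⟨?_, fun X v hv => ?_⟩
  · rw [hq, ← Category.assoc, (ha m (by omega)).1, zero_comp]
  · obtain ⟨h, rfl⟩ := (ha m (by omega)).2 v hv
    have hepi : ∀ k : C' ⟶ X, (c (m + 1) ≫ g) ≫ k = 0 → k = 0 := by
      intro k hk
      rw [hq, Category.assoc] at hk
      obtain ⟨t, ht⟩ := (ha (m + 1) le_rfl).2 _ hk
      have hgk : g ≫ k = 0 := by
        rw [hg, Category.assoc, ht, ← Category.assoc, hbn.1, zero_comp]
      rw [← Category.id_comp k, ← hfg, Category.assoc, hgk, comp_zero]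
    have hfac : a (m + 1) ≫ h = (c (m + 1) ≫ g) ≫ f ≫ bn ≫ h := by
      calc a (m + 1) ≫ h = c (m + 1) ≫ bn ≫ h := by rw [hc₁, Category.assoc]
        _ = c (m + 1) ≫ (bn ≫ d (m + 1) ≫ bn) ≫ h := by rw [← hreg]
        _ = c (m + 1) ≫ (g ≫ f) ≫ bn ≫ h := by rw [hgf]; simp only [Category.assoc]
        _ = (c (m + 1) ≫ g) ≫ f ≫ bn ≫ h := by simp only [Category.assoc]
    refine ⟨f ≫ bn ≫ h, hfac, fun k hk => ?_⟩
    rw [← sub_eq_zero]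
    apply hepi
    rw [Preadditive.comp_sub, ← hfac, ← hk, sub_self]
end

section
/- Let C be a preadditive category. Let a₀ : A₀ → A₁ be a morphism, let a₁ : A₁ → A₂ be a weak cokernel of a₀, let a₂ : A₂ → A₃ be a weak cokernel of a₁, and let b₁ : B₁ → A₂ be a monomorphism that is a weak kernel of a₂. Then there exists a morphism c₁ : A₁ → B₁ with a₁ = b₁ ∘ c₁, the morphism b₁ is a split monomorphism, and every morphism c₁ : A₁ → B₁ satisfying a₁ = b₁ ∘ c₁ is a cokernel of a₀. -/
/-!
STATEMENT 5: Let `C` be a preadditive category.  Let `a₀ : A₀ ⟶ A₁` be a morphism, let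
`a₁ : A₁ ⟶ A₂` be a weak cokernel of `a₀`, let `a₂ : A₂ ⟶ A₃` be a weak cokernel of
`a₁`, and let `b₁ : B₁ ⟶ A₂` be a monomorphism that is a weak kernel of `a₂`.  Then
there exists a morphism `c₁ : A₁ ⟶ B₁` with `a₁ = b₁ ∘ c₁`, the morphism `b₁` is a
split monomorphism, and every morphism `c₁ : A₁ ⟶ B₁` satisfying `a₁ = b₁ ∘ c₁` is a
cokernel of `a₀`.
-/

open CategoryTheory CategoryTheory.Limits

universe v u

variable {C : Type u} [Category.{v} C] [Preadditive C]

/-- If `b` is a monic weak kernel of a weak cokernel `a₂` of `c ≫ b`, then a morphism `s` through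
which `c` factors as `(c ≫ b) ≫ s` is a retraction of `b`. -/
theorem IsWeakKernel.comp_eq_id {A₁ A₂ A₃ B : C} {c : A₁ ⟶ B} {b : B ⟶ A₂} {a₂ : A₂ ⟶ A₃}
    [Mono b] (hb : IsWeakKernel b a₂) (ha₂ : IsWeakCokernel (c ≫ b) a₂)
    {s : A₂ ⟶ B} (hs : c = (c ≫ b) ≫ s) : b ≫ s = 𝟙 B := by
  obtain ⟨t, ht⟩ := ha₂.2 (𝟙 A₂ - s ≫ b) (by
    rw [Preadditive.comp_sub, Category.comp_id, ← Category.assoc, ← hs, sub_self])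
  have h : b ≫ (𝟙 A₂ - s ≫ b) = 0 := by
    rw [ht, ← Category.assoc, hb.1, zero_comp]
  rw [Preadditive.comp_sub, Category.comp_id, sub_eq_zero] at h
  rw [← cancel_mono b, Category.assoc, Category.id_comp, ← h]

/-- If `c ≫ b` is a weak cokernel of `a₀` with `b` a split monomorphism, `a₀ ≫ c = 0`, and `b` is
annihilated by a weak cokernel of `c ≫ b`, then `c` is a cokernel of `a₀`. -/
theorem IsWeakCokernel.isCokernel_s5 {A₀ A₁ A₂ A₃ B : C} {a₀ : A₀ ⟶ A₁} {c : A₁ ⟶ B} {b : B ⟶ A₂}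
    {a₂ : A₂ ⟶ A₃} (hc : IsWeakCokernel a₀ (c ≫ b)) (ha₂ : IsWeakCokernel (c ≫ b) a₂)
    (hb : b ≫ a₂ = 0) (h₀ : a₀ ≫ c = 0) {s : A₂ ⟶ B} (hs : b ≫ s = 𝟙 B) :
    IsCokernel a₀ c := by
  have : Epi c := Preadditive.epi_of_cancel_zero c fun {X} g hg => by
    obtain ⟨t, ht⟩ := ha₂.2 (s ≫ g) (by
      rw [Category.assoc, ← Category.assoc b, hs, Category.id_comp, hg])
    rw [← Category.id_comp g, ← hs, Category.assoc, ht, ← Category.assoc, hb, zero_comp]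
  refine ⟨h₀, fun X v hv => ?_⟩
  obtain ⟨h, rfl⟩ := hc.2 v hv
  refine ⟨b ≫ h, Category.assoc _ _ _, fun k hk => ?_⟩
  rw [← cancel_epi c, ← hk, Category.assoc]

theorem cokernel_of_weak_kernel_mono
    {A₀ A₁ A₂ A₃ B₁ : C}
    (a₀ : A₀ ⟶ A₁) (a₁ : A₁ ⟶ A₂) (a₂ : A₂ ⟶ A₃) (b₁ : B₁ ⟶ A₂)
    (ha₁ : IsWeakCokernel a₀ a₁) (ha₂ : IsWeakCokernel a₁ a₂)
    (hb₁ : Mono b₁) (hwk : IsWeakKernel b₁ a₂) :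
    (∃ c₁ : A₁ ⟶ B₁, a₁ = c₁ ≫ b₁) ∧
    (∃ r : A₂ ⟶ B₁, b₁ ≫ r = 𝟙 B₁) ∧
    (∀ c₁ : A₁ ⟶ B₁, a₁ = c₁ ≫ b₁ → IsCokernel a₀ c₁) := by
  obtain ⟨c, rfl⟩ := hwk.2 a₁ ha₂.1
  have h₀ : a₀ ≫ c = 0 := by
    rw [← cancel_mono b₁, Category.assoc, ha₁.1, zero_comp]
  obtain ⟨s, hs⟩ := ha₁.2 c h₀
  have hbs := hwk.comp_eq_id ha₂ hs
  refine ⟨⟨c, rfl⟩, ⟨s, hbs⟩, fun c₁ hc₁ => ?_⟩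
  obtain rfl := (cancel_mono b₁).1 hc₁
  exact ha₁.isCokernel_s5 ha₂ hwk.1 h₀ hbs
end

section
/- Let C be an idempotent complete preadditive category. Let a₀ : A₀ → A₁ be a morphism, let a₁ : A₁ → A₂ be a weak cokernel of a₀, and suppose a₁ = b ∘ c where b : B → A₂ is a monomorphism and c : A₁ → B is a split epimorphism with section r : B → A₁ (so c ∘ r = 1). If f : C' → A₁ and g : A₁ → C' are morphisms with f ∘ g = 1 − r ∘ c and g ∘ f = 1, then g ∘ a₀ : A₀ → C' is an epimorphism and f ∘ (g ∘ a₀) = a₀; in particular, g ∘ a₀ is a 0-cokernel of a₀, so a₀ admits a 0-cokernel. -/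
/-!
STATEMENT 6: Let `C` be an idempotent complete preadditive category.  Let
`a₀ : A₀ ⟶ A₁` be a morphism, let `a₁ : A₁ ⟶ A₂` be a weak cokernel of `a₀`, and
suppose `a₁ = b ∘ c` where `b : B ⟶ A₂` is a monomorphism and `c : A₁ ⟶ B` is a split
epimorphism with section `r : B ⟶ A₁` (so `c ∘ r = 1`).  If `f : C' ⟶ A₁` and
`g : A₁ ⟶ C'` are morphisms with `f ∘ g = 1 − r ∘ c` and `g ∘ f = 1`, then
`g ∘ a₀ : A₀ ⟶ C'` is an epimorphism and `f ∘ (g ∘ a₀) = a₀`; in particular, `g ∘ a₀`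
is a `0`-cokernel of `a₀`, so `a₀` admits a `0`-cokernel.
-/

open CategoryTheory CategoryTheory.Limits

universe v u

variable {C : Type u} [Category.{v} C] [Preadditive C]

/-- `e : A ⟶ I` is a `0`-cokernel of `f : A ⟶ B`: `e` is an epimorphism and `f = m ∘ e`
for some split monomorphism `m : I ⟶ B`. -/
def Is0Cokernel {A B I : C} (f : A ⟶ B) (e : A ⟶ I) : Prop :=
  Epi e ∧ ∃ m : I ⟶ B, (∃ r : B ⟶ I, m ≫ r = 𝟙 I) ∧ f = e ≫ m

theorem zero_cokernel_from_idempotent_splitting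
    [IsIdempotentComplete C]
    {A₀ A₁ A₂ B C' : C}
    (a₀ : A₀ ⟶ A₁) (a₁ : A₁ ⟶ A₂)
    (ha₁ : IsWeakCokernel a₀ a₁)
    (b : B ⟶ A₂) (c : A₁ ⟶ B) (r : B ⟶ A₁)
    (hb : Mono b) (hfact : a₁ = c ≫ b) (hsec : r ≫ c = 𝟙 B)
    (f : C' ⟶ A₁) (g : A₁ ⟶ C')
    (hfg : g ≫ f = 𝟙 A₁ - c ≫ r) (hgf : f ≫ g = 𝟙 C') :
    Epi (a₀ ≫ g) ∧ (a₀ ≫ g) ≫ f = a₀ ∧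
    Is0Cokernel a₀ (a₀ ≫ g) ∧
    ∃ (I : C) (e : A₀ ⟶ I), Is0Cokernel a₀ e := by
  have hac : a₀ ≫ c = 0 := by
    rw [← cancel_mono b, Category.assoc, ← hfact, ha₁.1, zero_comp]
  have hfc : f ≫ c = 0 := by
    have h : f ≫ (g ≫ f) ≫ c = f ≫ c := by
      rw [Category.assoc, reassoc_of% hgf]
    rw [← h, hfg, Preadditive.sub_comp, Category.assoc, hsec]
    simp
  have hcomp : (a₀ ≫ g) ≫ f = a₀ := by
    rw [Category.assoc, hfg, Preadditive.comp_sub, reassoc_of% hac]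
    simp
  have hepi : Epi (a₀ ≫ g) := by
    refine Preadditive.epi_of_cancel_zero _ fun h hh => ?_
    obtain ⟨k, hk⟩ := ha₁.2 (g ≫ h) (by rw [← Category.assoc, hh])
    rw [← Category.id_comp h, ← hgf, Category.assoc, hk, hfact, Category.assoc,
      reassoc_of% hfc, zero_comp]
  have hzero : Is0Cokernel a₀ (a₀ ≫ g) := ⟨hepi, f, ⟨g, hgf⟩, hcomp.symm⟩
  exact ⟨hepi, hcomp, hzero, C', _, hzero⟩
end

section
/- Let Λ be a ring that is right coherent and left coherent. Then for every nonnegative integer n, the following are equivalent: (i) every finitely presented right Λ-module has projective dimension at most n; (ii) every finitely presented left Λ-module has projective dimension at most n. Consequently, the global dimension of the category of finitely presented right Λ-modules equals the global dimension of the category of finitely presented left Λ-modules. -/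
/-!
STATEMENT 7: Let `Λ` be a ring that is right coherent and left coherent.  Then for every
nonnegative integer `n`, the following are equivalent:
(i) every finitely presented right `Λ`-module has projective dimension at most `n`;
(ii) every finitely presented left `Λ`-module has projective dimension at most `n`.
Consequently, the global dimension of the category of finitely presented right
`Λ`-modules equals the global dimension of the category of finitely presented left
`Λ`-modules.

Right `Λ`-modules are encoded as (left) `Λᵐᵒᵖ`-modules; a right ideal of `Λ` is an ideal
of `Λᵐᵒᵖ`.  "Projective dimension at most `n`" is expressed by the existence of a
projective resolution `0 → Pₙ → ⋯ → P₀ → M → 0`, i.e. a projective resolution whose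
terms vanish in degrees `> n`.
-/

open CategoryTheory

universe u

/-- `M` has projective dimension at most `n`: it admits a projective resolution
vanishing in degrees greater than `n`, i.e. one of the form `0 → Pₙ → ⋯ → P₀ → M → 0`. -/
def ProjDimLE {R : Type u} [Ring R] (M : ModuleCat.{u} R) (n : ℕ) : Prop :=
  ∃ P : ProjectiveResolution M, ∀ i, n < i → Limits.IsZero (P.complex.X i)

/-- The projective dimension of a module, as an element of `ℕ∞` (equal to `⊤` if the
module has no finite projective resolution). -/
noncomputable def projDim {R : Type u} [Ring R] (M : ModuleCat.{u} R) : ℕ∞ :=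
  sInf {d : ℕ∞ | ∃ n : ℕ, d = n ∧ ProjDimLE M n}

/-- The global dimension of the category of finitely presented `R`-modules: the supremum
of the projective dimensions of the finitely presented `R`-modules. -/
noncomputable def fpGlobalDim (R : Type u) [Ring R] : ℕ∞ :=
  ⨆ (M : ModuleCat.{u} R) (_ : Module.FinitePresentation R M), projDim M

/-- `Λ` is right coherent: every finitely generated right ideal of `Λ` (i.e. ideal of
`Λᵐᵒᵖ`) is finitely presented as a right `Λ`-module (i.e. as a `Λᵐᵒᵖ`-module). -/
def RightCoherentRing (Λ : Type u) [Ring Λ] : Prop :=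
  ∀ I : Ideal Λᵐᵒᵖ, I.FG → Module.FinitePresentation Λᵐᵒᵖ I

/-- `Λ` is left coherent: every finitely generated left ideal of `Λ` is finitely
presented as a left `Λ`-module. -/
def LeftCoherentRing (Λ : Type u) [Ring Λ] : Prop :=
  ∀ I : Ideal Λ, I.FG → Module.FinitePresentation Λ I

namespace CategoryTheory.ProjectiveResolution

variable {C : Type*} [Category* C] [Abelian C]

lemma hasProjectiveDimensionLE {X : C} (P : ProjectiveResolution X) {n : ℕ}
    (h : ∀ i, n < i → Limits.IsZero (P.complex.X i)) : HasProjectiveDimensionLE X n := by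
  let := HasExt.standard C
  refine HasProjectiveDimensionLT.mk fun i hi Y e ↦ ?_
  obtain ⟨f, hf, rfl⟩ := P.extMk_surjective e (i + 1) rfl
  obtain rfl : f = 0 := (h i hi).eq_of_src _ _
  simp

/-- The augmentation map of a projective resolution. -/
def augmentation {X : C} (P : ProjectiveResolution X) : P.complex.X 0 ⟶ X := P.π.f 0

instance {X : C} (P : ProjectiveResolution X) : Epi P.augmentation :=
  inferInstanceAs (Epi (P.π.f 0))

@[simp]
lemma d_comp_augmentation {X : C} (P : ProjectiveResolution X) :
    P.complex.d 1 0 ≫ P.augmentation = 0 :=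
  P.complex_d_comp_π_f_zero

@[simp]
lemma d_comp_augmentation_comp {X Y : C} (P : ProjectiveResolution X) (f : X ⟶ Y) :
    P.complex.d 1 0 ≫ P.augmentation ≫ f = 0 := by
  rw [← Category.assoc, d_comp_augmentation, Limits.zero_comp]

lemma exact_augmentation {X : C} (P : ProjectiveResolution X) :
    (ShortComplex.mk _ _ P.d_comp_augmentation).Exact :=
  P.exact₀

/-- Splicing a short exact sequence whose middle term is projective with a projective
resolution of its first term. -/
noncomputable def splice {S : ShortComplex C} (hS : S.ShortExact) [Projective S.X₂]
    (Q : ProjectiveResolution S.X₁) : ProjectiveResolution S.X₃ where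
  complex := Q.complex.augment (Q.augmentation ≫ S.f) (by simp)
  projective n := by
    cases n
    · dsimp; infer_instance
    · dsimp; infer_instance
  π := (ChainComplex.toSingle₀Equiv _ _).symm ⟨S.g, by
    change (Q.augmentation ≫ S.f) ≫ S.g = 0
    simp⟩
  quasiIso := ⟨fun n ↦ by
    have hw : (Q.augmentation ≫ S.f) ≫ S.g = 0 := by simp
    have hf : Mono S.f := hS.mono_f
    have hg : Epi S.g := hS.epi_g
    match n with
    | 0 =>
      rw [ChainComplex.quasiIsoAt₀_iff, ShortComplex.quasiIso_iff_of_zeros']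
      · refine (ShortComplex.exact_and_epi_g_iff_of_iso
          (S₂ := ShortComplex.mk (Q.augmentation ≫ S.f) S.g (by simp)) ?_).2 ⟨?_, hg⟩
        · refine ShortComplex.isoMk (Iso.refl _) (Iso.refl _) (Iso.refl _) ?_ ?_
          · exact (Category.id_comp _).trans (Category.comp_id _).symm
          · have h : ((ChainComplex.toSingle₀Equiv (Q.complex.augment (Q.augmentation ≫ S.f)
                (by simp)) S.X₃).symm ⟨S.g, hw⟩).f 0 = S.g :=
              ChainComplex.toSingle₀Equiv_symm_apply_f_zero _ _
            exact (Category.id_comp _).trans (h.symm.trans (Category.comp_id _).symm)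
        · let α : ShortComplex.mk (Q.augmentation ≫ S.f) S.g (by simp) ⟶ S :=
            { τ₁ := Q.augmentation, τ₂ := 𝟙 _, τ₃ := 𝟙 _ }
          have : Epi α.τ₁ := inferInstanceAs (Epi Q.augmentation)
          have : IsIso α.τ₂ := inferInstanceAs (IsIso (𝟙 _))
          have : Mono α.τ₃ := inferInstanceAs (Mono (𝟙 _))
          exact (ShortComplex.exact_iff_of_epi_of_isIso_of_mono α).2 hS.exact
      all_goals rfl
    | 1 =>
      rw [quasiIsoAt_iff_exactAt' _ _ (ChainComplex.exactAt_succ_single_obj _ _),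
        HomologicalComplex.exactAt_iff' _ 2 1 0 (by simp) (by simp)]
      let α : ShortComplex.mk _ _ Q.d_comp_augmentation ⟶
          ShortComplex.mk (Q.complex.d 1 0) (Q.augmentation ≫ S.f) (by simp) :=
        { τ₁ := 𝟙 _, τ₂ := 𝟙 _, τ₃ := S.f }
      have : Epi α.τ₁ := inferInstanceAs (Epi (𝟙 _))
      have : IsIso α.τ₂ := inferInstanceAs (IsIso (𝟙 _))
      have : Mono α.τ₃ := hf
      exact (ShortComplex.exact_iff_of_epi_of_isIso_of_mono α).1 Q.exact_augmentation
    | n + 2 =>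
      rw [quasiIsoAt_iff_exactAt' _ _ (ChainComplex.exactAt_succ_single_obj _ _),
        HomologicalComplex.exactAt_iff' _ (n + 3) (n + 2) (n + 1) (by simp) (by simp)]
      exact Q.exact_succ n⟩

end CategoryTheory.ProjectiveResolution

lemma ProjDimLE.of_shortExact {R : Type u} [Ring R] {S : ShortComplex (ModuleCat.{u} R)}
    (hS : S.ShortExact) [Projective S.X₂] {n : ℕ} (h : ProjDimLE S.X₁ n) :
    ProjDimLE S.X₃ (n + 1) := by
  obtain ⟨Q, hQ⟩ := h
  refine ⟨Q.splice hS, fun i hi ↦ ?_⟩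
  obtain _ | i := i
  · lia
  · exact hQ i (by lia)

lemma projDimLE_of_projective {R : Type u} [Ring R] (M : ModuleCat.{u} R) [Projective M] (n : ℕ) :
    ProjDimLE M n :=
  ⟨.self M, fun i hi ↦ HomologicalComplex.isZero_single_obj_X _ _ _ _ (by simp; lia)⟩

section Coherent

variable {R : Type*} [Ring R]

lemma Module.FinitePresentation.of_injective_of_coherent
    (hR : ∀ I : Ideal R, I.FG → Module.FinitePresentation R I) {n : ℕ} {M : Type*}
    [AddCommGroup M] [Module R M] [Module.Finite R M] (t : M →ₗ[R] (Fin n → R))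
    (ht : Function.Injective t) :
    Module.FinitePresentation R M := by
  induction n generalizing M with
  | zero =>
    have : Subsingleton M := ht.subsingleton
    exact Module.finitePresentation_of_projective R M
  | succ n ih =>
    let l : M →ₗ[R] R := LinearMap.proj 0 ∘ₗ t
    have := hR l.range (Module.Finite.iff_fg.1 inferInstance)
    have hl := l.surjective_rangeRestrict
    have : Module.Finite R l.rangeRestrict.ker :=
      Module.Finite.iff_fg.2 (Module.FinitePresentation.fg_ker _ hl)
    have := ih (LinearMap.funLeft R R (Fin.succ (n := n)) ∘ₗ t ∘ₗ l.rangeRestrict.ker.subtype) (by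
      rw [injective_iff_map_eq_zero]
      intro x hx
      refine Subtype.ext (ht ?_)
      ext i
      refine Fin.cases ?_ (fun j ↦ ?_) i
      · have hx' : l x = 0 := congrArg Subtype.val (LinearMap.mem_ker.1 x.2)
        simpa [l] using hx'
      · simpa using! congrFun hx j)
    exact Module.finitePresentation_of_ker _ hl

lemma Submodule.FG.finitePresentation_of_coherent
    (hR : ∀ I : Ideal R, I.FG → Module.FinitePresentation R I) {n : ℕ} {N : Submodule R (Fin n → R)}
    (hN : N.FG) : Module.FinitePresentation R N :=
  have : Module.Finite R N := Module.Finite.iff_fg.2 hN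
  .of_injective_of_coherent hR N.subtype N.subtype_injective

end Coherent

/-- The sequence of left modules `Rᶜ → Rᵃ → Rᵇ` given by right multiplication of row vectors by
`C` and `B` is exact. -/
def Matrix.RowExact {R : Type*} [Ring R] {a b c : ℕ} (C : Matrix (Fin c) (Fin a) R)
    (B : Matrix (Fin a) (Fin b) R) : Prop :=
  Function.Exact C.vecMulLinear B.vecMulLinear

lemma Matrix.exists_vecMulLinear_eq {R : Type*} [Ring R] {a b : ℕ}
    (f : (Fin a → R) →ₗ[R] (Fin b → R)) :
    ∃ B : Matrix (Fin a) (Fin b) R, B.vecMulLinear = f :=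
  ⟨Matrix.toLinearMapRight'.symm f, Matrix.toLinearMapRight'.apply_symm_apply f⟩

lemma Matrix.exists_rowExact {R : Type*} [Ring R]
    (hR : ∀ I : Ideal R, I.FG → Module.FinitePresentation R I) {a b : ℕ}
    (B : Matrix (Fin a) (Fin b) R) : ∃ (c : ℕ) (C : Matrix (Fin c) (Fin a) R), C.RowExact B := by
  have := Submodule.FG.finitePresentation_of_coherent hR
    (N := B.vecMulLinear.range) (Module.Finite.iff_fg.1 inferInstance)
  have h := Module.FinitePresentation.fg_ker _ B.vecMulLinear.surjective_rangeRestrict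
  rw [LinearMap.ker_rangeRestrict] at h
  obtain ⟨c, f, hf⟩ := (Submodule.fg_iff_exists_fin_linearMap _ _).1 h
  obtain ⟨C, rfl⟩ := Matrix.exists_vecMulLinear_eq f
  exact ⟨c, C, LinearMap.exact_iff.2 hf.symm⟩

section RightAction

variable {R S : Type*} [Ring R] [Ring S] (e : R ≃+* Sᵐᵒᵖ)
variable {M N : Type*} [AddCommGroup M] [Module S M] [AddCommGroup N] [Module S N]

open MulOpposite

/-- For an anti-isomorphism between `R` and `S`, an `S`-module is a right `R`-module; this is
right multiplication of row vectors with entries in such a module by a matrix over `R`. -/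
def rowMul {a b : ℕ} (B : Matrix (Fin a) (Fin b) R) : (Fin a → M) →+ (Fin b → M) where
  toFun x j := ∑ i, unop (e (B i j)) • x i
  map_zero' := by ext; simp
  map_add' x y := by ext; simp [Finset.sum_add_distrib]

lemma rowMul_apply {a b : ℕ} (B : Matrix (Fin a) (Fin b) R) (x : Fin a → M) (j : Fin b) :
    rowMul e B x j = ∑ i, unop (e (B i j)) • x i := rfl

lemma rowMul_mul {a b c : ℕ} (C : Matrix (Fin c) (Fin a) R) (B : Matrix (Fin a) (Fin b) R)
    (x : Fin c → M) : rowMul e (C * B) x = rowMul e B (rowMul e C x) := by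
  ext j
  simp only [rowMul_apply, Matrix.mul_apply, map_sum, map_mul, Finset.unop_sum, unop_mul,
    Finset.sum_smul, Finset.smul_sum, mul_smul]
  exact Finset.sum_comm

lemma rowMul_sub {a b : ℕ} (B C : Matrix (Fin a) (Fin b) R) (x : Fin a → M) :
    rowMul e (B - C) x = rowMul e B x - rowMul e C x := by
  ext j
  simp [rowMul_apply, sub_smul]

lemma rowMul_one {a : ℕ} (x : Fin a → M) : rowMul e 1 x = x := by
  ext j
  simp [rowMul_apply, Matrix.one_apply, apply_ite e, apply_ite unop, ite_smul]

lemma rowMul_zero {a b : ℕ} (x : Fin a → M) :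
    rowMul e (0 : Matrix (Fin a) (Fin b) R) x = 0 := by
  ext j
  simp [rowMul_apply]

lemma rowMul_comp {a b : ℕ} (f : M →ₗ[S] N) (B : Matrix (Fin a) (Fin b) R) (x : Fin a → M) :
    rowMul e B (f ∘ x) = f ∘ rowMul e B x := by
  ext j
  simp [rowMul_apply]

lemma rowMul_self {a b : ℕ} (B : Matrix (Fin a) (Fin b) R) (u : Fin a → R) :
    rowMul e B (fun i ↦ unop (e (u i))) = fun j ↦ unop (e ((Matrix.vecMul u B) j)) := by
  ext j
  simp [rowMul_apply, Matrix.vecMul, dotProduct]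

variable {a b c : ℕ} {C : Matrix (Fin c) (Fin a) R} {B : Matrix (Fin a) (Fin b) R}

lemma Matrix.RowExact.mul_eq_zero (h : C.RowExact B) : C * B = 0 := by
  ext i j
  have := congrFun (h.apply_apply_eq_zero (Pi.single i 1)) j
  simpa [Matrix.row, Matrix.vecMul, Matrix.mul_apply] using! this

lemma Matrix.RowExact.exists_rowMul_eq (h : C.RowExact B) {k : ℕ} (x : Fin a → Fin k → S)
    (hx : rowMul e B x = 0) : ∃ y, rowMul e C y = x := by
  have key (l : Fin k) : ∃ v : Fin c → R, Matrix.vecMul v C = fun i ↦ e.symm (op (x i l)) := by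
    refine (h _).1 ?_
    have h1 := rowMul_comp e (LinearMap.proj (R := S) (φ := fun _ : Fin k ↦ S) l) B x
    have h2 := rowMul_self e B (fun i ↦ e.symm (op (x i l)))
    ext j
    have h3 := congrFun (h2.symm.trans (by simpa using! h1)) j
    simpa [hx] using! h3
  choose v hv using key
  refine ⟨fun j l ↦ unop (e (v l j)), ?_⟩
  ext i l
  have h2 := congrFun (rowMul_self e C (v l)) i
  rw [hv] at h2
  simpa [rowMul_apply] using h2

/-- Vanishing of `Tor` in degree `n + 1` of the right module `M` and the cokernel of `B`, computed
with any resolution of the cokernel by finite free modules that starts with `B`. -/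
def TorVanishes (M : Type*) [AddCommGroup M] [Module S M] :
    ∀ (_ : ℕ) {a b : ℕ} (_ : Matrix (Fin a) (Fin b) R), Prop
  | 0, a, _, B => ∀ (c : ℕ) (C : Matrix (Fin c) (Fin a) R), C.RowExact B →
      ∀ x : Fin a → M, rowMul e B x = 0 → ∃ y, rowMul e C y = x
  | n + 1, a, _, B => ∀ (c : ℕ) (C : Matrix (Fin c) (Fin a) R), C.RowExact B →
      TorVanishes M n C

variable {e}

lemma TorVanishes.ker (hR : ∀ I : Ideal R, I.FG → Module.FinitePresentation R I) {k : ℕ}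
    {f : (Fin k → S) →ₗ[S] M} (hf : Function.Surjective f) {n a b : ℕ}
    {B : Matrix (Fin a) (Fin b) R} (h : TorVanishes e M (n + 1) B) :
    TorVanishes e f.ker n B := by
  induction n generalizing a b with
  | zero =>
    intro c C hC x hx
    obtain ⟨d, D, hD⟩ := Matrix.exists_rowExact hR C
    obtain ⟨y, hy⟩ := hC.exists_rowMul_eq e (f.ker.subtype ∘ x) (by rw [rowMul_comp, hx]; ext; simp)
    obtain ⟨z, hz⟩ := h c C hC d D hD (f ∘ y) (by
      rw [rowMul_comp, hy]
      ext i
      simp)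
    choose w hw using fun i ↦ hf (z i)
    obtain rfl : f ∘ w = z := funext hw
    refine ⟨fun i ↦ ⟨y i - rowMul e D w i, ?_⟩, ?_⟩
    · rw [rowMul_comp] at hz
      simpa [sub_eq_zero] using! (congrFun hz i).symm
    · apply f.ker.subtype_injective.comp_left
      change f.ker.subtype ∘ _ = _
      rw [← rowMul_comp]
      change rowMul e C (y - rowMul e D w) = _
      rw [map_sub, hy, ← rowMul_mul, hD.mul_eq_zero, rowMul_zero, sub_zero]
  | succ n ih => exact fun c C hC ↦ ih (h c C hC)

variable (e M) in
lemma torVanishes_zero_of_projective (B : Matrix (Fin a) (Fin b) R)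
    [Module.Projective R ((Fin b → R) ⧸ B.vecMulLinear.range)] : TorVanishes e M 0 B := by
  intro c C hC x hx
  obtain ⟨s, hs⟩ := Module.projective_lifting_property B.vecMulLinear.range.mkQ .id
    B.vecMulLinear.range.mkQ_surjective
  have hφ (u : Fin b → R) : ∃ v, B.vecMulLinear v = u - s (B.vecMulLinear.range.mkQ u) := by
    rw [← LinearMap.mem_range, ← Submodule.Quotient.mk_eq_zero, ← Submodule.mkQ_apply,
      map_sub, sub_eq_zero]
    exact (LinearMap.congr_fun hs _).symm
  choose d hd using fun i ↦ hφ (Pi.single i 1)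
  obtain ⟨D, hD⟩ := Matrix.exists_vecMulLinear_eq ((Pi.basisFun R (Fin b)).constr ℕ d)
  have hDB : B.vecMulLinear ∘ₗ D.vecMulLinear = .id - s ∘ₗ B.vecMulLinear.range.mkQ := by
    refine (Pi.basisFun R (Fin b)).ext fun i ↦ ?_
    rw [LinearMap.comp_apply, hD, Module.Basis.constr_basis, hd]
    simp
  have hBDB (u : Fin a → R) : B.vecMulLinear (u - Matrix.vecMul u (B * D)) = 0 := by
    have h0 : B.vecMulLinear.range.mkQ (B.vecMulLinear u) = 0 := by
      simp only [Submodule.mkQ_apply, Submodule.Quotient.mk_eq_zero, LinearMap.mem_range_self]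
    have := LinearMap.congr_fun hDB (B.vecMulLinear u)
    rw [LinearMap.sub_apply, LinearMap.comp_apply s, h0, map_zero, sub_zero] at this
    rw [map_sub, sub_eq_zero, ← Matrix.vecMul_vecMul]
    exact this.symm
  choose v hv using fun i ↦ (hC _).1 (hBDB (Pi.single i 1))
  have hVC : Matrix.of v * C = 1 - B * D := by
    ext i j
    have := congrFun (hv i) j
    simpa [Matrix.mul_apply, Matrix.vecMul, dotProduct, Matrix.one_apply, Pi.single_apply,
      eq_comm] using! this
  refine ⟨rowMul e (Matrix.of v) x, ?_⟩
  rw [← rowMul_mul, hVC, rowMul_sub, rowMul_one, rowMul_mul, hx, map_zero, sub_zero]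

lemma projective_of_torVanishes_zero (hR : ∀ I : Ideal R, I.FG → Module.FinitePresentation R I)
    [Module.FinitePresentation S M]
    (h : ∀ (a b : ℕ) (B : Matrix (Fin a) (Fin b) R), TorVanishes e M 0 B) :
    Module.Projective S M := by
  obtain ⟨n, m, f, g, hf, hfg⟩ := Module.FinitePresentation.exists_fin' S M
  let B : Matrix (Fin n) (Fin m) R := .of fun i j ↦ e.symm (op (g (Pi.single j 1) i))
  obtain ⟨c, C, hC⟩ := Matrix.exists_rowExact hR B
  obtain ⟨y, hy⟩ := h n m B c C hC (fun i ↦ f (Pi.single i 1)) (by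
    ext j
    have := hfg.apply_apply_eq_zero (Pi.single j 1)
    rw [pi_eq_sum_univ' (g (Pi.single j 1))] at this
    simpa [rowMul_apply, B] using! this)
  let p : (Fin n → S) →ₗ[S] (Fin c → S) :=
    (Pi.basisFun S (Fin n)).constr ℕ fun i l ↦ unop (e (C l i))
  have hp : f.ker ≤ p.ker := by
    rw [LinearMap.exact_iff.1 hfg, LinearMap.range_le_ker_iff]
    refine (Pi.basisFun S (Fin m)).ext fun j ↦ ?_
    ext l
    have := congrArg (unop ∘ e) (congrFun (congrFun hC.mul_eq_zero l) j)
    simpa [p, Module.Basis.constr_apply_fintype, Matrix.mul_apply, B] using this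
  let q : (Fin c → S) →ₗ[S] M := (Pi.basisFun S (Fin c)).constr ℕ y
  have hqp : q ∘ₗ p = f := by
    refine (Pi.basisFun S (Fin n)).ext fun i ↦ ?_
    have := congrFun hy i
    simpa [p, q, Module.Basis.constr_apply_fintype, rowMul_apply] using this
  refine Module.Projective.of_split (f.ker.liftQ p hp ∘ₗ
    (f.quotKerEquivOfSurjective hf).symm.toLinearMap) q ?_
  ext z
  obtain ⟨w, rfl⟩ := hf z
  have : (f.quotKerEquivOfSurjective hf).symm (f w) = f.ker.mkQ w := by
    rw [LinearEquiv.symm_apply_eq]; rfl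
  simpa [this] using! LinearMap.congr_fun hqp w

end RightAction

section Dimension

variable {R S : Type u} [Ring R] [Ring S]

open ModuleCat in
lemma shortExact_of_injective_of_surjective {M₁ M₂ M₃ : Type u} [AddCommGroup M₁] [AddCommGroup M₂]
    [AddCommGroup M₃] [Module R M₁] [Module R M₂] [Module R M₃] (f : M₁ →ₗ[R] M₂)
    (g : M₂ →ₗ[R] M₃) (hf : Function.Injective f) (hg : Function.Surjective g)
    (h : Function.Exact f g) :
    (ShortComplex.mk (ofHom f) (ofHom g) (by
      ext x; exact h.apply_apply_eq_zero x)).ShortExact where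
  exact := (ShortComplex.ShortExact.moduleCat_exact_iff_function_exact _).2 h
  mono_f := (ModuleCat.mono_iff_injective _).2 hf
  epi_g := (ModuleCat.epi_iff_surjective _).2 hg

lemma torVanishes_of_hasProjectiveDimensionLE (e : R ≃+* Sᵐᵒᵖ) (M : Type*) [AddCommGroup M]
    [Module S M] {n a b : ℕ} (B : Matrix (Fin a) (Fin b) R)
    (h : HasProjectiveDimensionLE (ModuleCat.of R ((Fin b → R) ⧸ B.vecMulLinear.range)) n) :
    TorVanishes e M n B := by
  induction n generalizing a b with
  | zero =>
    have := (projective_iff_hasProjectiveDimensionLE_zero _).2 h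
    have := (IsProjective.iff_projective ((Fin b → R) ⧸ B.vecMulLinear.range)).2 this
    exact torVanishes_zero_of_projective e M B
  | succ n ih =>
    intro c C hC
    apply ih C
    have hCB : C.vecMulLinear.range = B.vecMulLinear.ker := (LinearMap.exact_iff.1 hC).symm
    let f := C.vecMulLinear.range.liftQ B.vecMulLinear hCB.le
    have hf : Function.Injective f := by
      rw [← LinearMap.ker_eq_bot, Submodule.ker_liftQ_eq_bot _ _ _ hCB.ge]
    have hS := shortExact_of_injective_of_surjective f B.vecMulLinear.range.mkQ hf
      (Submodule.mkQ_surjective _) (by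
        rw [LinearMap.exact_iff, Submodule.ker_mkQ, Submodule.range_liftQ])
    have : Projective (ModuleCat.of R (Fin b → R)) :=
      (IsProjective.iff_projective (Fin b → R)).1 inferInstance
    exact (hS.hasProjectiveDimensionLT_X₃_iff n this).1 h

lemma projDimLE_of_torVanishes (e : R ≃+* Sᵐᵒᵖ)
    (hR : ∀ I : Ideal R, I.FG → Module.FinitePresentation R I)
    (hS : ∀ I : Ideal S, I.FG → Module.FinitePresentation S I) {n : ℕ}
    (M : Type u) [AddCommGroup M] [Module S M] [Module.FinitePresentation S M]
    (h : ∀ (a b : ℕ) (B : Matrix (Fin a) (Fin b) R), TorVanishes e M n B) :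
    ProjDimLE (ModuleCat.of S M) n := by
  induction n generalizing M with
  | zero =>
    have := (IsProjective.iff_projective M).1 (projective_of_torVanishes_zero hR h)
    exact projDimLE_of_projective _ _
  | succ n ih =>
    obtain ⟨k, _, f, _, hf, _⟩ := Module.FinitePresentation.exists_fin' S M
    have := (Module.FinitePresentation.fg_ker f hf).finitePresentation_of_coherent hS
    have hK := ih f.ker fun a b B ↦ (h a b B).ker hR hf
    have hE := shortExact_of_injective_of_surjective f.ker.subtype f f.ker.subtype_injective hf
      (LinearMap.exact_subtype_ker_map f)
    have : Projective (ModuleCat.of S (Fin k → S)) :=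
      (IsProjective.iff_projective (Fin k → S)).1 inferInstance
    exact ProjDimLE.of_shortExact hE hK

lemma forall_projDimLE_of_ringEquiv_mulOpposite (e : R ≃+* Sᵐᵒᵖ)
    (hR : ∀ I : Ideal R, I.FG → Module.FinitePresentation R I)
    (hS : ∀ I : Ideal S, I.FG → Module.FinitePresentation S I) {n : ℕ}
    (h : ∀ M : ModuleCat.{u} R, Module.FinitePresentation R M → ProjDimLE M n)
    (M : ModuleCat.{u} S) (hM : Module.FinitePresentation S M) : ProjDimLE M n := by
  refine projDimLE_of_torVanishes e hR hS M fun a b B ↦ ?_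
  obtain ⟨P, hP⟩ := h (ModuleCat.of R ((Fin b → R) ⧸ B.vecMulLinear.range))
    (Module.finitePresentation_of_free_of_surjective B.vecMulLinear.range.mkQ
      (Submodule.mkQ_surjective _) (by
        rw [Submodule.ker_mkQ]
        exact Module.Finite.iff_fg.1 inferInstance))
  exact torVanishes_of_hasProjectiveDimensionLE e M B (P.hasProjectiveDimensionLE hP)

lemma projDim_le_iff (M : ModuleCat.{u} R) (n : ℕ) : projDim M ≤ n ↔ ProjDimLE M n := by
  refine ⟨fun h ↦ ?_, fun h ↦ sInf_le ⟨n, rfl, h⟩⟩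
  obtain hs | hs := Set.eq_empty_or_nonempty {d : ℕ∞ | ∃ n : ℕ, d = n ∧ ProjDimLE M n}
  · rw [projDim, hs, sInf_empty] at h
    exact absurd h (by simp)
  · obtain ⟨m, hm, P, hP⟩ := csInf_mem hs
    rw [projDim, hm, Nat.cast_le] at h
    exact ⟨P, fun i hi ↦ hP i (by lia)⟩

lemma fpGlobalDim_le_iff (n : ℕ) : fpGlobalDim R ≤ n ↔
    ∀ M : ModuleCat.{u} R, Module.FinitePresentation R M → ProjDimLE M n := by
  simp only [fpGlobalDim, iSup_le_iff, projDim_le_iff]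

end Dimension

theorem fpGlobalDim_eq_of_coherent (Λ : Type u) [Ring Λ]
    (hr : RightCoherentRing Λ) (hl : LeftCoherentRing Λ) :
    (∀ n : ℕ,
      (∀ M : ModuleCat.{u} Λᵐᵒᵖ, Module.FinitePresentation Λᵐᵒᵖ M → ProjDimLE M n) ↔
      (∀ M : ModuleCat.{u} Λ, Module.FinitePresentation Λ M → ProjDimLE M n)) ∧
    fpGlobalDim Λᵐᵒᵖ = fpGlobalDim Λ := by
  have key (n : ℕ) :
      (∀ M : ModuleCat.{u} Λᵐᵒᵖ, Module.FinitePresentation Λᵐᵒᵖ M → ProjDimLE M n) ↔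
        (∀ M : ModuleCat.{u} Λ, Module.FinitePresentation Λ M → ProjDimLE M n) :=
    ⟨forall_projDimLE_of_ringEquiv_mulOpposite (RingEquiv.refl _) hr hl,
      forall_projDimLE_of_ringEquiv_mulOpposite (RingEquiv.opOp Λ) hl hr⟩
  refine ⟨key, eq_of_forall_ge_iff fun c ↦ ?_⟩
  induction c with
  | top => simp
  | coe n => rw [fpGlobalDim_le_iff, fpGlobalDim_le_iff, key]
end
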